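/- arXiv:math/0306126 — 7 statements merged into one kernel-verified Lean document; each statement's English description precedes it below -/
import Mathlib

section
/- Let k be an integral domain, n a positive integer, and X = (x_{ij}) the generic n×n matrix over the polynomial ring k[x_{ij}] in the n² indeterminates x_{ij}. Then the determinant det(X) is an irreducible element of the polynomial ring k[x_{ij}]. -/
open MvPolynomial in
theorem aux_vars_split {k σ : Type*} [CommRing k] [IsDomain k] (S : σ → Prop) [DecidablePred S]
    (f g : MvPolynomial σ k) (h0 : f * g ≠ 0)
    (hd : (aeval (R := k) (fun s => (if S s then Polynomial.X else 1) *
      Polynomial.C (X s : MvPolynomial σ k)) (f * g)).natDegree ≤ 1) :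
    (∀ s ∈ f.vars, ¬ S s) ∨ (∀ s ∈ g.vars, ¬ S s) := by
  classical
  set φ : MvPolynomial σ k →ₐ[k] Polynomial (MvPolynomial σ k) :=
    aeval (R := k) (fun s => (if S s then Polynomial.X else 1) *
      Polynomial.C (X s : MvPolynomial σ k)) with hφ
  have e1 : ∀ p, (φ p).eval 1 = p := by
    intro p
    have : ((Polynomial.aeval (R := MvPolynomial σ k) (1 : MvPolynomial σ k)).restrictScalars k).comp φ
        = AlgHom.id k _ := by
      ext s : 1
      simp only [hφ, AlgHom.comp_apply, aeval_X]
      split_ifs <;> simp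
    simpa [Polynomial.aeval_def, Polynomial.eval₂_eq_eval_map] using DFunLike.congr_fun this p
  have e0 : ∀ p, (φ p).eval 0 = bind₁ (fun s => if S s then 0 else X s) p := by
    intro p
    have : ((Polynomial.aeval (R := MvPolynomial σ k) (0 : MvPolynomial σ k)).restrictScalars k).comp φ
        = bind₁ (fun s => if S s then 0 else X s) := by
      ext s : 1
      simp only [hφ, AlgHom.comp_apply, aeval_X, bind₁_X_right]
      split_ifs <;> simp
    simpa [Polynomial.aeval_def, Polynomial.eval₂_eq_eval_map] using DFunLike.congr_fun this p
  have key : ∀ p, (φ p).natDegree = 0 → ∀ s ∈ p.vars, ¬ S s := by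
    intro p hp s hs hS
    obtain ⟨c, hc⟩ := Polynomial.natDegree_eq_zero.1 hp
    have h1 := e1 p
    have h2 := e0 p
    rw [← hc, Polynomial.eval_C] at h1 h2
    rw [h1] at h2
    rw [h2] at hs
    obtain ⟨i, -, hi⟩ := mem_vars_bind₁ _ _ hs
    split_ifs at hi with h
    · simp at hi
    · rw [vars_X, Finset.mem_singleton] at hi
      exact h (hi ▸ hS)
  have hne : ∀ p, p ≠ 0 → φ p ≠ 0 := by
    intro p hp h
    apply hp
    rw [← e1 p, h, Polynomial.eval_zero]
  rw [map_mul, Polynomial.natDegree_mul (hne _ (left_ne_zero_of_mul h0))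
    (hne _ (right_ne_zero_of_mul h0))] at hd
  rcases Nat.eq_zero_or_pos (φ f).natDegree with h | h
  · exact Or.inl (key f h)
  · exact Or.inr (key g (by omega))

open MvPolynomial in
theorem aux_row {k : Type*} [CommRing k] [IsDomain k] {n : ℕ} (r : Fin n) :
    (aeval (R := k) (fun s : Fin n × Fin n => (if s.1 = r then Polynomial.X else 1) *
      Polynomial.C (X s : MvPolynomial (Fin n × Fin n) k))
      (Matrix.of fun i j => (X (i, j) : MvPolynomial (Fin n × Fin n) k)).det).natDegree ≤ 1 := by
  rw [AlgHom.map_det]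
  have : (AlgHom.mapMatrix (aeval (R := k) (fun s : Fin n × Fin n => (if s.1 = r then Polynomial.X else 1) *
      Polynomial.C (X s : MvPolynomial (Fin n × Fin n) k))))
      (Matrix.of fun i j => (X (i, j) : MvPolynomial (Fin n × Fin n) k)) =
      Matrix.of fun i j => (if i = r then Polynomial.X else 1) * (Polynomial.C.mapMatrix
        (Matrix.of fun i j => (X (i, j) : MvPolynomial (Fin n × Fin n) k))) i j := by
    ext1 i j
    simp
  rw [this, Matrix.det_mul_column, ← RingHom.map_det, Finset.prod_ite_eq' Finset.univ r]
  simp only [Finset.mem_univ, if_true]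
  refine Polynomial.natDegree_mul_le.trans ?_
  simp

open MvPolynomial in
theorem aux_col {k : Type*} [CommRing k] [IsDomain k] {n : ℕ} (r : Fin n) :
    (aeval (R := k) (fun s : Fin n × Fin n => (if s.2 = r then Polynomial.X else 1) *
      Polynomial.C (X s : MvPolynomial (Fin n × Fin n) k))
      (Matrix.of fun i j => (X (i, j) : MvPolynomial (Fin n × Fin n) k)).det).natDegree ≤ 1 := by
  rw [AlgHom.map_det]
  have : (AlgHom.mapMatrix (aeval (R := k) (fun s : Fin n × Fin n => (if s.2 = r then Polynomial.X else 1) *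
      Polynomial.C (X s : MvPolynomial (Fin n × Fin n) k))))
      (Matrix.of fun i j => (X (i, j) : MvPolynomial (Fin n × Fin n) k)) =
      Matrix.of fun i j => (if j = r then Polynomial.X else 1) * (Polynomial.C.mapMatrix
        (Matrix.of fun i j => (X (i, j) : MvPolynomial (Fin n × Fin n) k))) i j := by
    ext1 i j
    simp
  rw [this, Matrix.det_mul_row, ← RingHom.map_det, Finset.prod_ite_eq' Finset.univ r]
  simp only [Finset.mem_univ, if_true]
  refine Polynomial.natDegree_mul_le.trans ?_
  simp

open MvPolynomial in
theorem aux_eval {k : Type*} [CommRing k] {n : ℕ} (A : Matrix (Fin n) (Fin n) k) :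
    eval (fun s : Fin n × Fin n => A s.1 s.2)
      (Matrix.of fun i j => (X (i, j) : MvPolynomial (Fin n × Fin n) k)).det = A.det := by
  rw [RingHom.map_det]
  congr 1
  ext i j
  simp

open MvPolynomial in
theorem aux_mem {k : Type*} [CommRing k] [IsDomain k] {n : ℕ} (i j : Fin n) :
    (i, j) ∈ (Matrix.of fun i j => (X (i, j) : MvPolynomial (Fin n × Fin n) k)).det.vars := by
  by_contra h
  let P : Matrix (Fin n) (Fin n) k := (Equiv.swap i j).permMatrix k
  let Q : Matrix (Fin n) (Fin n) k := P.updateRow i 0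
  have hP : P.det ≠ 0 := by
    simp only [P, Matrix.det_permutation]
    rcases Int.units_eq_one_or (Equiv.Perm.sign (Equiv.swap i j)) with h | h <;> simp [h]
  have hQ : Q.det = 0 := Matrix.det_eq_zero_of_row_eq_zero i (by simp [Q])
  apply hP
  rw [← hQ, ← aux_eval P, ← aux_eval Q]
  refine eval₂Hom_congr' rfl ?_ rfl
  rintro ⟨a, b⟩ hab -
  by_cases ha : a = i
  · subst ha
    have hb : b ≠ j := fun hb => h (hb ▸ hab)
    simp [Q, P, Equiv.Perm.permMatrix, PEquiv.toMatrix_apply, hb.symm]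
  · simp [Q, ha]

open MvPolynomial in
theorem aux_unit {k : Type*} [CommRing k] [IsDomain k] {n : ℕ} (r : Fin n)
    (f g : MvPolynomial (Fin n × Fin n) k)
    (h : (Matrix.of fun i j => (X (i, j) : MvPolynomial (Fin n × Fin n) k)).det = f * g)
    (hg : ∀ s ∈ g.vars, ¬ s.1 = r) : IsUnit g := by
  have h1 := aux_eval (1 : Matrix (Fin n) (Fin n) k)
  rw [h, Matrix.det_one, map_mul] at h1
  have h0 : f * g ≠ 0 := by
    rintro h'
    rw [← map_mul, h', map_zero] at h1
    exact zero_ne_one h1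
  have hv : g.vars = ∅ := by
    rw [Finset.eq_empty_iff_forall_notMem]
    rintro ⟨a, b⟩ hab
    rcases aux_vars_split (fun s => s.2 = b) f g h0 (h ▸ aux_col b) with h2 | h2
    · have := aux_mem (k := k) r b
      rw [h] at this
      classical
      rcases Finset.mem_union.1 (vars_mul f g this) with h3 | h3
      · exact h2 _ h3 rfl
      · exact hg _ h3 rfl
    · exact h2 _ hab rfl
  obtain ⟨c, rfl⟩ : ∃ c, g = C c := ⟨_, (vars_eq_empty_iff_eq_C).1 hv⟩
  rw [eval_C] at h1
  exact (IsUnit.of_mul_eq_one_right _ h1).map C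

/-- The determinant of the generic `n × n` matrix over an integral domain `k`
is an irreducible element of the polynomial ring `k[xᵢⱼ]`. -/
theorem det_generic_matrix_irreducible
    (k : Type*) [CommRing k] [IsDomain k] (n : ℕ) (hn : 0 < n)
    (X : Matrix (Fin n) (Fin n) (MvPolynomial (Fin n × Fin n) k))
    (hX : ∀ i j, X i j = MvPolynomial.X (i, j)) :
    Irreducible X.det := by
  obtain rfl : X = Matrix.of fun i j => MvPolynomial.X (i, j) := by
    ext1 i j
    exact hX i j
  have : Nonempty (Fin n) := ⟨⟨0, hn⟩⟩
  constructor
  · intro hu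
    have := hu.map (MvPolynomial.eval (fun s : Fin n × Fin n => (0 : Matrix (Fin n) (Fin n) k) s.1 s.2))
    rw [aux_eval, Matrix.det_zero] at this
    exact not_isUnit_zero this
  · intro f g h
    have h0 : f * g ≠ 0 := by
      intro h'
      have h1 := aux_eval (1 : Matrix (Fin n) (Fin n) k)
      rw [h, h', map_zero, Matrix.det_one] at h1
      exact zero_ne_one h1
    rcases aux_vars_split (fun s => s.1 = ⟨0, hn⟩) f g h0 (h ▸ aux_row _) with h2 | h2
    · exact Or.inl (aux_unit ⟨0, hn⟩ g f (h.trans (mul_comm _ _)) h2)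
    · exact Or.inr (aux_unit ⟨0, hn⟩ f g h h2)
end

section
/- Let k be an integral domain, n a positive integer, and X the generic n×n matrix over the polynomial ring k[x_{ij}]. If X = Y·Z for n×n matrices Y, Z over k[x_{ij}], then Y or Z is an invertible matrix over k[x_{ij}] (i.e., a unit of the ring of n×n matrices over k[x_{ij}]). -/
open MvPolynomial in
/-- Set all variables satisfying `p` to zero. -/
noncomputable def gmKill {k : Type*} [CommRing k] {s : Type*} (p : s → Prop) [DecidablePred p] :
    MvPolynomial s k →ₐ[k] MvPolynomial s k :=
  aeval (fun v => if p v then 0 else X v)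

open MvPolynomial in
/-- Multiply all variables satisfying `p` by a new variable. -/
noncomputable def gmScale {k : Type*} [CommRing k] {s : Type*} (p : s → Prop) [DecidablePred p] :
    MvPolynomial s k →ₐ[k] Polynomial (MvPolynomial s k) :=
  aeval (fun v => if p v then Polynomial.X * Polynomial.C (X v) else Polynomial.C (X v))

open MvPolynomial in
lemma gmScale_eval_one {k : Type*} [CommRing k] {s : Type*} (p : s → Prop) [DecidablePred p]
    (f : MvPolynomial s k) : (gmScale p f).eval 1 = f := by
  have : ((Polynomial.aeval (R := MvPolynomial s k) (1 : MvPolynomial s k)).restrictScalars k).comp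
      (gmScale (k := k) p) = AlgHom.id k _ := by
    ext v : 1
    by_cases h : p v <;> simp [gmScale, h]
  have h := DFunLike.congr_fun this f
  simpa [Polynomial.aeval_def, Polynomial.eval₂_eq_eval_map] using h

open MvPolynomial in
lemma gmScale_eval_zero {k : Type*} [CommRing k] {s : Type*} (p : s → Prop) [DecidablePred p]
    (f : MvPolynomial s k) : (gmScale p f).eval 0 = gmKill p f := by
  have : ((Polynomial.aeval (R := MvPolynomial s k) (0 : MvPolynomial s k)).restrictScalars k).comp
      (gmScale (k := k) p) = gmKill p := by
    ext v : 1
    by_cases h : p v <;> simp [gmScale, gmKill, h]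
  have h := DFunLike.congr_fun this f
  rw [← h]
  simp

lemma gmKill_of_natDegree {k : Type*} [CommRing k] {s : Type*} (p : s → Prop) [DecidablePred p]
    (f : MvPolynomial s k) (h : (gmScale p f).natDegree = 0) : gmKill p f = f := by
  obtain ⟨c, hc⟩ := Polynomial.natDegree_eq_zero.mp h
  have h1 := gmScale_eval_one p f
  have h0 := gmScale_eval_zero p f
  rw [← hc, Polynomial.eval_C] at h1 h0
  rw [← h0, h1]

lemma gmKill_or {k : Type*} [CommRing k] [IsDomain k] {s : Type*} (p : s → Prop) [DecidablePred p]
    (f g : MvPolynomial s k) (hne : f * g ≠ 0)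
    (h : gmScale p (f * g) = Polynomial.X * Polynomial.C (f * g)) :
    gmKill p f = f ∨ gmKill p g = g := by
  have hd := congrArg Polynomial.natDegree h
  have hne' : gmScale p f * gmScale p g ≠ 0 := by
    rw [← map_mul, h]
    exact mul_ne_zero Polynomial.X_ne_zero (by simpa using hne)
  rw [map_mul, Polynomial.natDegree_mul (left_ne_zero_of_mul hne') (right_ne_zero_of_mul hne'),
    Polynomial.natDegree_mul Polynomial.X_ne_zero (by simpa using hne),
    Polynomial.natDegree_X, Polynomial.natDegree_C] at hd
  rcases Nat.eq_zero_or_pos (gmScale p f).natDegree with h0 | h0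
  · exact Or.inl (gmKill_of_natDegree p f h0)
  · exact Or.inr (gmKill_of_natDegree p g (by omega))

lemma gmKill_mono {k : Type*} [CommRing k] {s : Type*} (p q : s → Prop) [DecidablePred p]
    [DecidablePred q] (hqp : ∀ v, q v → p v)
    (f : MvPolynomial s k) (h : gmKill p f = f) : gmKill q f = f := by
  have : (gmKill (k := k) q).comp (gmKill p) = gmKill p := by
    ext v : 1
    by_cases h : p v
    · simp [gmKill, h]
    · have : ¬ q v := fun hq => h (hqp v hq)
      simp [gmKill, h, this]
  have h2 := DFunLike.congr_fun this f
  simpa [h] using h2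

lemma gmKill_not_mem {k : Type*} [CommRing k] [IsDomain k] {s : Type*} (p : s → Prop)
    [DecidablePred p] (f : MvPolynomial s k) (h : gmKill p f = f) (v : s) (hv : p v) :
    v ∉ f.vars := by
  classical
  intro hm
  rw [← h] at hm
  obtain ⟨w, hw, hw'⟩ := MvPolynomial.mem_vars_bind₁ (fun v => if p v then 0 else MvPolynomial.X v) f hm
  by_cases hp : p w
  · simp [hp] at hw'
  · simp [hp] at hw'
    exact hp (hw' ▸ hv)

lemma gmScale_row {k : Type*} [CommRing k] {n : ℕ} (i : Fin n) :
    gmScale (fun v : Fin n × Fin n => v.1 = i) (Matrix.mvPolynomialX (Fin n) (Fin n) k).det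
      = Polynomial.X * Polynomial.C (Matrix.mvPolynomialX (Fin n) (Fin n) k).det := by
  rw [AlgHom.map_det, RingHom.map_det]
  have := Matrix.det_updateRow_smul
    (Polynomial.C.mapMatrix (Matrix.mvPolynomialX (Fin n) (Fin n) k)) i Polynomial.X
    ((Polynomial.C.mapMatrix (Matrix.mvPolynomialX (Fin n) (Fin n) k)) i)
  rw [Matrix.updateRow_eq_self] at this
  rw [← this]
  congr 1
  ext1 a b
  by_cases h : a = i
  · subst h; simp [gmScale]
  · simp [gmScale, h, Matrix.updateRow_ne]

lemma gmScale_col {k : Type*} [CommRing k] {n : ℕ} (i : Fin n) :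
    gmScale (fun v : Fin n × Fin n => v.2 = i) (Matrix.mvPolynomialX (Fin n) (Fin n) k).det
      = Polynomial.X * Polynomial.C (Matrix.mvPolynomialX (Fin n) (Fin n) k).det := by
  rw [AlgHom.map_det, RingHom.map_det]
  have := Matrix.det_updateCol_smul
    (Polynomial.C.mapMatrix (Matrix.mvPolynomialX (Fin n) (Fin n) k)) i Polynomial.X
    (fun a => (Polynomial.C.mapMatrix (Matrix.mvPolynomialX (Fin n) (Fin n) k)) a i)
  rw [Matrix.updateCol_eq_self] at this
  rw [← this]
  congr 1
  ext1 a b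
  by_cases h : b = i
  · subst h; simp [gmScale]
  · simp [gmScale, h, Matrix.updateCol_ne]

lemma gmKill_det_ne {k : Type*} [CommRing k] [IsDomain k] {n : ℕ} (i j : Fin n) :
    gmKill (fun v : Fin n × Fin n => v = (i, j)) (Matrix.mvPolynomialX (Fin n) (Fin n) k).det
      ≠ (Matrix.mvPolynomialX (Fin n) (Fin n) k).det := by
  intro h
  let A : Matrix (Fin n) (Fin n) k := (Equiv.swap i j).permMatrix k
  have h2 := congrArg (MvPolynomial.eval (fun p : Fin n × Fin n => A p.1 p.2)) h
  have hA : MvPolynomial.eval (fun p : Fin n × Fin n => A p.1 p.2)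
      (Matrix.mvPolynomialX (Fin n) (Fin n) k).det = A.det := by
    rw [RingHom.map_det, Matrix.mvPolynomialX_mapMatrix_eval]
  rw [hA, AlgHom.map_det, RingHom.map_det, Matrix.det_eq_zero_of_row_eq_zero i] at h2
  · have hu : IsUnit A.det := by
      rw [Matrix.det_permutation]
      exact (Units.isUnit _).map (Int.castRingHom k)
    rw [← h2] at hu
    exact not_isUnit_zero hu
  · intro b
    by_cases hb : b = j
    · simp [gmKill, hb]
    · have : j ≠ b := fun h => hb h.symm
      simp [gmKill, hb, A, Equiv.Perm.permMatrix, PEquiv.toMatrix_apply, this]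

lemma gm_key {k : Type*} [CommRing k] [IsDomain k] {n : ℕ} (i : Fin n)
    (f g : MvPolynomial (Fin n × Fin n) k)
    (h : (Matrix.mvPolynomialX (Fin n) (Fin n) k).det = f * g)
    (hg : gmKill (fun v : Fin n × Fin n => v.1 = i) g = g) : IsUnit g := by
  have hne : f * g ≠ 0 := h ▸ Matrix.det_mvPolynomialX_ne_zero (Fin n) k
  have hcol : ∀ j, gmKill (fun v : Fin n × Fin n => v.2 = j) g = g := by
    intro j
    refine (gmKill_or _ f g hne (h ▸ gmScale_col j)).resolve_left fun hf => ?_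
    apply gmKill_det_ne (k := k) i j
    rw [h, map_mul, gmKill_mono _ _ (by rintro v rfl; rfl) f hf,
      gmKill_mono _ _ (by rintro v rfl; rfl) g hg]
  have hv : g.vars = ∅ := by
    ext v
    simp [gmKill_not_mem _ g (hcol v.2) v rfl]
  obtain ⟨c, rfl⟩ : ∃ c, g = MvPolynomial.C c :=
    ⟨_, MvPolynomial.vars_eq_empty_iff_eq_C.mp hv⟩
  have h2 := congrArg (MvPolynomial.eval (fun p : Fin n × Fin n => (1 : Matrix _ _ k) p.1 p.2)) h
  rw [RingHom.map_det, Matrix.mvPolynomialX_mapMatrix_eval, Matrix.det_one, map_mul,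
    MvPolynomial.eval_C] at h2
  exact (IsUnit.of_mul_eq_one_right _ h2.symm).map MvPolynomial.C

/-- If the generic `n × n` matrix `X` over an integral domain `k` factors as `X = Y * Z`,
then `Y` or `Z` is invertible over `k[xᵢⱼ]`. -/
theorem generic_matrix_factor_isUnit
    (k : Type*) [CommRing k] [IsDomain k] (n : ℕ) (hn : 0 < n)
    (X Y Z : Matrix (Fin n) (Fin n) (MvPolynomial (Fin n × Fin n) k))
    (hX : ∀ i j, X i j = MvPolynomial.X (i, j))
    (hYZ : X = Y * Z) :
    IsUnit Y ∨ IsUnit Z := by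
  have hX' : X = Matrix.mvPolynomialX (Fin n) (Fin n) k := by
    ext1 i j
    simp [hX]
  have h : (Matrix.mvPolynomialX (Fin n) (Fin n) k).det = Y.det * Z.det := by
    rw [← hX', hYZ, Matrix.det_mul]
  have hne : Y.det * Z.det ≠ 0 := h ▸ Matrix.det_mvPolynomialX_ne_zero (Fin n) k
  rw [Matrix.isUnit_iff_isUnit_det, Matrix.isUnit_iff_isUnit_det]
  rcases gmKill_or _ _ _ hne (h ▸ gmScale_row ⟨0, hn⟩) with h1 | h1
  · exact Or.inl (gm_key _ _ _ (h.trans (mul_comm _ _)) h1)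
  · exact Or.inr (gm_key _ _ _ h h1)
end

section
/- Let k be an integral domain, n a positive integer, X the generic n×n matrix over k[x_{ij}], and adj(X) its classical adjoint (adjugate). If adj(X) = Y·Z for n×n matrices Y, Z over k[x_{ij}], then there exists an integer d with 0 ≤ d ≤ n−1 such that det(Y) is associated to det(X)^d and det(Z) is associated to det(X)^{n−1−d} in k[x_{ij}]. -/
open MvPolynomial in
/-- Scale the variables in `S` by a new variable `T`. -/
noncomputable def scaleHom {σ R : Type*} [CommRing R] (S : σ → Prop) [DecidablePred S] :
    MvPolynomial σ R →ₐ[R] Polynomial (MvPolynomial σ R) :=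
  aeval (fun p => if S p then Polynomial.C (X p) * Polynomial.X else Polynomial.C (X p))

open MvPolynomial in
lemma scaleHom_eval_one {σ R : Type*} [CommRing R] (S : σ → Prop) [DecidablePred S]
    (f : MvPolynomial σ R) : (scaleHom S f).eval 1 = f := by
  induction f using MvPolynomial.induction_on with
  | C a => simp [scaleHom, algebraMap_eq, Polynomial.algebraMap_apply]
  | add p q hp hq => simp [hp, hq]
  | mul_X p i hp =>
    rw [map_mul, Polynomial.eval_mul, hp]
    congr 1
    simp only [scaleHom, aeval_X]
    split_ifs <;> simp

open MvPolynomial in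
lemma scaleHom_eval_zero {σ R : Type*} [CommRing R] (S : σ → Prop) [DecidablePred S]
    (f : MvPolynomial σ R) :
    (scaleHom S f).eval 0 = bind₁ (fun p => if S p then 0 else X p) f := by
  induction f using MvPolynomial.induction_on with
  | C a => simp [scaleHom, algebraMap_eq, Polynomial.algebraMap_apply]
  | add p q hp hq => simp [hp, hq]
  | mul_X p i hp =>
    rw [map_mul, Polynomial.eval_mul, hp, map_mul]
    congr 1
    simp only [scaleHom, aeval_X, bind₁_X_right]
    split_ifs <;> simp

open MvPolynomial in
lemma not_mem_vars_of_natDegree {σ R : Type*} [CommRing R] [Nontrivial R]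
    (S : σ → Prop) [DecidablePred S]
    (f : MvPolynomial σ R) (h : (scaleHom S f).natDegree = 0) (p : σ) (hp : S p) :
    p ∉ f.vars := by
  classical
  have h1 := scaleHom_eval_one S f
  have h0 := scaleHom_eval_zero S f
  rw [Polynomial.eq_C_of_natDegree_eq_zero h, Polynomial.eval_C] at h0 h1
  have e : f = bind₁ (fun p => if S p then 0 else X p) f := h1.symm.trans h0
  intro hm
  rw [e] at hm
  obtain ⟨q, -, hq⟩ := Finset.mem_biUnion.1 (vars_bind₁ _ _ hm)
  by_cases hS : S q
  · simp [hS] at hq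
  · simp [hS] at hq
    subst hq
    exact hS hp

open MvPolynomial in
lemma split_vars {σ R : Type*} [CommRing R] [IsDomain R] (S : σ → Prop) [DecidablePred S]
    (D f g : MvPolynomial σ R) (hD : D ≠ 0) (hfg : D = f * g)
    (hS : scaleHom S D = Polynomial.X * Polynomial.C D) :
    (∀ p, S p → p ∉ f.vars) ∨ (∀ p, S p → p ∉ g.vars) := by
  have hne : scaleHom S D ≠ 0 := by
    rw [hS]; exact mul_ne_zero Polynomial.X_ne_zero (by simpa using hD)
  have hdeg : (scaleHom S D).natDegree = 1 := by
    rw [hS, Polynomial.natDegree_mul Polynomial.X_ne_zero (by simpa using hD)]; simp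
  rw [hfg, map_mul] at hne hdeg
  rw [Polynomial.natDegree_mul (left_ne_zero_of_mul hne) (right_ne_zero_of_mul hne)] at hdeg
  rcases Nat.eq_zero_or_pos (scaleHom S f).natDegree with h | h
  · exact Or.inl (not_mem_vars_of_natDegree S f h)
  · exact Or.inr (not_mem_vars_of_natDegree S g (by omega))

section
open Matrix

lemma scale_row {R : Type*} [CommRing R] {n : ℕ} (i : Fin n) :
    scaleHom (fun p : Fin n × Fin n => p.1 = i) (mvPolynomialX (Fin n) (Fin n) R).det =
      Polynomial.X * Polynomial.C (mvPolynomialX (Fin n) (Fin n) R).det := by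
  have : (scaleHom (fun p : Fin n × Fin n => p.1 = i)).mapMatrix
      (mvPolynomialX (Fin n) (Fin n) R) =
      diagonal (fun a => if a = i then Polynomial.X else 1) *
      Polynomial.C.mapMatrix (mvPolynomialX (Fin n) (Fin n) R) := by
    ext1 a b
    rw [diagonal_mul]
    simp only [AlgHom.mapMatrix_apply, RingHom.mapMatrix_apply, Matrix.map_apply,
      mvPolynomialX_apply, scaleHom, MvPolynomial.aeval_X]
    split_ifs
    · exact mul_comm _ _
    · exact (one_mul _).symm
  rw [AlgHom.map_det, this, det_mul, det_diagonal, ← RingHom.map_det]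
  simp

lemma scale_col {R : Type*} [CommRing R] {n : ℕ} (i : Fin n) :
    scaleHom (fun p : Fin n × Fin n => p.2 = i) (mvPolynomialX (Fin n) (Fin n) R).det =
      Polynomial.X * Polynomial.C (mvPolynomialX (Fin n) (Fin n) R).det := by
  have : (scaleHom (fun p : Fin n × Fin n => p.2 = i)).mapMatrix
      (mvPolynomialX (Fin n) (Fin n) R) =
      Polynomial.C.mapMatrix (mvPolynomialX (Fin n) (Fin n) R) *
      diagonal (fun a => if a = i then Polynomial.X else 1) := by
    ext1 a b
    rw [mul_diagonal]
    simp only [AlgHom.mapMatrix_apply, RingHom.mapMatrix_apply, Matrix.map_apply,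
      mvPolynomialX_apply, scaleHom, MvPolynomial.aeval_X]
    split_ifs <;> simp
  rw [AlgHom.map_det, this, det_mul, det_diagonal, ← RingHom.map_det]
  rw [mul_comm]
  simp

lemma no_mixed {R : Type*} [CommRing R] [IsDomain R] {n : ℕ}
    (f g : MvPolynomial (Fin n × Fin n) R)
    (hfg : (mvPolynomialX (Fin n) (Fin n) R).det = f * g) (i j : Fin n)
    (hf : (i, j) ∉ f.vars) (hg : (i, j) ∉ g.vars) : False := by
  let P : Matrix (Fin n) (Fin n) R := (Equiv.swap i j).permMatrix R
  let P' : Matrix (Fin n) (Fin n) R := P.updateRow i 0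
  have key : ∀ h : MvPolynomial (Fin n × Fin n) R, (i, j) ∉ h.vars →
      MvPolynomial.eval (fun p => P p.1 p.2) h = MvPolynomial.eval (fun p => P' p.1 p.2) h := by
    intro h hh
    refine MvPolynomial.eval₂Hom_congr' rfl ?_ rfl
    rintro ⟨a, b⟩ hab -
    by_cases ha : a = i
    · subst ha
      have hb : b ≠ j := by rintro rfl; exact hh hab
      simp [P', P, Equiv.Perm.permMatrix, PEquiv.toMatrix_apply, hb.symm]
    · simp [P', ha]
  have e1 : MvPolynomial.eval (fun p => P p.1 p.2) (mvPolynomialX (Fin n) (Fin n) R).det = P.det :=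
    eval_det_mvPolynomialX _ _ _
  have e2 : MvPolynomial.eval (fun p => P' p.1 p.2) (mvPolynomialX (Fin n) (Fin n) R).det
    = P'.det := eval_det_mvPolynomialX _ _ _
  have z : P'.det = 0 := det_eq_zero_of_row_eq_zero i (by simp [P'])
  rw [hfg, map_mul, key f hf, key g hg, ← map_mul, ← hfg, e2, z] at e1
  have : P.det ≠ 0 := by
    simp only [P, det_permutation]
    rcases Int.units_eq_one_or (Equiv.Perm.sign (Equiv.swap i j)) with h | h <;> simp [h]
  exact this e1.symm

lemma unit_of_no_vars {R : Type*} [CommRing R] [IsDomain R] {n : ℕ}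
    (f g : MvPolynomial (Fin n × Fin n) R)
    (hfg : (mvPolynomialX (Fin n) (Fin n) R).det = f * g)
    (hf : ∀ p, p ∉ f.vars) : IsUnit f := by
  have hv : f.vars = ∅ := Finset.eq_empty_of_forall_notMem hf
  obtain ⟨c, rfl⟩ : ∃ c, f = MvPolynomial.C c :=
    ⟨_, MvPolynomial.vars_eq_empty_iff_eq_C.1 hv⟩
  have e := congrArg (MvPolynomial.eval (fun p => (1 : Matrix (Fin n) (Fin n) R) p.1 p.2)) hfg
  have e1 : MvPolynomial.eval (fun p => (1 : Matrix (Fin n) (Fin n) R) p.1 p.2)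
    (mvPolynomialX (Fin n) (Fin n) R).det = (1 : Matrix (Fin n) (Fin n) R).det :=
    eval_det_mvPolynomialX _ _ _
  rw [e1, det_one, map_mul, MvPolynomial.eval_C] at e
  exact (IsUnit.of_mul_eq_one _ e.symm).map MvPolynomial.C

lemma irreducible_det {R : Type*} [CommRing R] [IsDomain R] {n : ℕ} (hn : 0 < n) :
    Irreducible (mvPolynomialX (Fin n) (Fin n) R).det := by
  constructor
  · intro hu
    have hu0 := hu.map (MvPolynomial.eval (fun _ => (0 : R)))
    have e : MvPolynomial.eval (fun _ => (0 : R)) (mvPolynomialX (Fin n) (Fin n) R).det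
      = (0 : Matrix (Fin n) (Fin n) R).det := eval_det_mvPolynomialX _ _ _
    have : Nonempty (Fin n) := ⟨⟨0, hn⟩⟩
    rw [e, det_zero] at hu0
    simp at hu0
  · intro f g hfg
    have hD := det_mvPolynomialX_ne_zero (Fin n) R
    have row := fun i => split_vars _ _ f g hD hfg (scale_row i)
    have col := fun i => split_vars _ _ f g hD hfg (scale_col i)
    rcases row ⟨0, hn⟩ with h | h
    · left
      refine unit_of_no_vars f g hfg ?_
      rintro ⟨a, b⟩
      rcases col b with h' | h'
      · exact h' _ rfl
      · exact (no_mixed f g hfg _ b (h (_, b) rfl) (h' (_, b) rfl)).elim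
    · right
      refine unit_of_no_vars g f (hfg.trans (mul_comm _ _)) ?_
      rintro ⟨a, b⟩
      rcases col b with h' | h'
      · exact (no_mixed f g hfg _ b (h' (_, b) rfl) (h (_, b) rfl)).elim
      · exact h' _ rfl

lemma map_det_generic {R K : Type*} [CommRing R] [CommRing K] (φ : R →+* K) {n : ℕ} :
    MvPolynomial.map φ (mvPolynomialX (Fin n) (Fin n) R).det =
      (mvPolynomialX (Fin n) (Fin n) K).det := by
  rw [RingHom.map_det]
  congr 1
  ext1 a b
  simp

/-- Descent of a factorization with constant `b` to the base ring. -/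
lemma descend {R K : Type*} [CommRing R] [CommRing K] (φ : R →+* K)
    (hφ : Function.Injective φ) {n : ℕ} (y : MvPolynomial (Fin n × Fin n) R) (b : K) (i : ℕ)
    (h : MvPolynomial.map φ y =
      MvPolynomial.C b * (mvPolynomialX (Fin n) (Fin n) K).det ^ i) :
    ∃ c : R, φ c = b ∧ y = MvPolynomial.C c * (mvPolynomialX (Fin n) (Fin n) R).det ^ i := by
  let pt : Fin n × Fin n → R := fun p => (1 : Matrix (Fin n) (Fin n) R) p.1 p.2
  have hpt : φ ∘ pt = fun p => (1 : Matrix (Fin n) (Fin n) K) p.1 p.2 := by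
    ext p
    simp only [pt, Function.comp, Matrix.one_apply]
    split_ifs <;> simp
  have e1 : MvPolynomial.eval (fun p => (1 : Matrix (Fin n) (Fin n) K) p.1 p.2)
    (mvPolynomialX (Fin n) (Fin n) K).det = (1 : Matrix (Fin n) (Fin n) K).det :=
    eval_det_mvPolynomialX _ _ _
  have hb : φ (MvPolynomial.eval pt y) = b := by
    rw [MvPolynomial.eval₂_comp, ← MvPolynomial.eval_map, hpt, h]
    simp [e1]
  refine ⟨_, hb, MvPolynomial.map_injective φ hφ ?_⟩
  rw [h, map_mul, map_pow, map_det_generic, MvPolynomial.map_C, hb]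
end


/-- If the adjugate of the generic `n × n` matrix `X` over an integral domain `k`
factors as `Y * Z`, then up to units `det Y = det X ^ d` and `det Z = det X ^ (n-1-d)`
for some `0 ≤ d ≤ n - 1`. -/
theorem adjugate_generic_factor_det
    (k : Type*) [CommRing k] [IsDomain k] (n : ℕ) (hn : 0 < n)
    (X Y Z : Matrix (Fin n) (Fin n) (MvPolynomial (Fin n × Fin n) k))
    (hX : ∀ i j, X i j = MvPolynomial.X (i, j))
    (hYZ : X.adjugate = Y * Z) :
    ∃ d : ℕ, d ≤ n - 1 ∧ Associated Y.det (X.det ^ d) ∧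
      Associated Z.det (X.det ^ (n - 1 - d)) := by
  obtain rfl : X = Matrix.mvPolynomialX (Fin n) (Fin n) k := by
    ext1 i j
    simp [hX]
  have hdet : Y.det * Z.det = (Matrix.mvPolynomialX (Fin n) (Fin n) k).det ^ (n - 1) := by
    rw [← Matrix.det_mul, ← hYZ, Matrix.det_adjugate, Fintype.card_fin]
  let K := FractionRing k
  let φ : k →+* K := algebraMap k K
  have hφ : Function.Injective φ := IsFractionRing.injective k K
  have hdK : MvPolynomial.map φ Y.det * MvPolynomial.map φ Z.det =
      1 * (Matrix.mvPolynomialX (Fin n) (Fin n) K).det ^ (n - 1) := by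
    rw [← map_mul, hdet, map_pow, map_det_generic, one_mul]
  have hprime : Prime (Matrix.mvPolynomialX (Fin n) (Fin n) K).det := (irreducible_det hn).prime
  obtain ⟨i, j, b, c, hij, hbc, hY, hZ⟩ := mul_eq_mul_prime_pow hprime hdK
  obtain ⟨b', -, rfl⟩ := MvPolynomial.isUnit_iff_eq_C_of_isReduced.1
    (IsUnit.of_mul_eq_one _ hbc.symm)
  obtain ⟨c', -, rfl⟩ := MvPolynomial.isUnit_iff_eq_C_of_isReduced.1
    (IsUnit.of_mul_eq_one_right _ hbc.symm)
  obtain ⟨u, hu, hYu⟩ := descend φ hφ _ _ _ hY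
  obtain ⟨v, hv, hZv⟩ := descend φ hφ _ _ _ hZ
  have huv : u * v = 1 := by
    apply hφ
    rw [map_mul, hu, hv, map_one]
    apply MvPolynomial.C_injective (Fin n × Fin n) K
    rw [map_mul, ← hbc, map_one]
  have hCu : IsUnit (MvPolynomial.C u : MvPolynomial (Fin n × Fin n) k) :=
    (IsUnit.of_mul_eq_one _ huv).map MvPolynomial.C
  have hCv : IsUnit (MvPolynomial.C v : MvPolynomial (Fin n × Fin n) k) :=
    (IsUnit.of_mul_eq_one _ ((mul_comm v u).trans huv)).map MvPolynomial.C
  refine ⟨i, by omega, ?_, ?_⟩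
  · rw [hYu]
    exact associated_unit_mul_left _ _ hCu
  · rw [hZv, show n - 1 - i = j by omega]
    exact associated_unit_mul_left _ _ hCv
end

section
/- Let k be an integral domain, n a positive integer, X the generic n×n matrix over k[x_{ij}], and adj(X) its adjugate. If adj(X) = Y·Z where Y and Z are n×n matrices over k[x_{ij}] neither of which is invertible over k[x_{ij}], then there exists an integer d with 0 < d < n−1 such that det(Y) is associated to det(X)^d and det(Z) is associated to det(X)^{n−1−d}. (In particular, no such factorization exists when n ≤ 2.) -/
open MvPolynomial in
/-- Set the variables in `S` to zero. -/
noncomputable def zeroOn {σ : Type*} {K : Type*} [CommRing K] (S : σ → Prop) [DecidablePred S] :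
    MvPolynomial σ K →ₐ[K] MvPolynomial σ K :=
  MvPolynomial.aeval (fun p => if S p then 0 else MvPolynomial.X p)

/-- Multiply the variables in `S` by a new variable. -/
noncomputable def scaleOn {σ : Type*} {K : Type*} [CommRing K] (S : σ → Prop) [DecidablePred S] :
    MvPolynomial σ K →ₐ[K] Polynomial (MvPolynomial σ K) :=
  MvPolynomial.aeval (fun p => (if S p then Polynomial.X else 1) * Polynomial.C (MvPolynomial.X p))

section
variable {σ : Type*} {K : Type*} [CommRing K]

theorem scaleOn_eval_zero (S : σ → Prop) [DecidablePred S] (f : MvPolynomial σ K) :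
    (scaleOn S f).eval 0 = zeroOn S f := by
  have : ((Polynomial.evalRingHom (0 : MvPolynomial σ K)).comp (scaleOn S).toRingHom) =
      (zeroOn S).toRingHom := by
    apply MvPolynomial.ringHom_ext
    · intro r
      simp [scaleOn, zeroOn, MvPolynomial.algebraMap_eq]
    · intro p
      by_cases h : S p <;> simp [scaleOn, zeroOn, h]
  exact congrArg (fun h => h f) this

theorem scaleOn_eval_one (S : σ → Prop) [DecidablePred S] (f : MvPolynomial σ K) :
    (scaleOn S f).eval 1 = f := by
  have : ((Polynomial.evalRingHom (1 : MvPolynomial σ K)).comp (scaleOn S).toRingHom) =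
      RingHom.id _ := by
    apply MvPolynomial.ringHom_ext
    · intro r
      simp [scaleOn, MvPolynomial.algebraMap_eq]
    · intro p
      by_cases h : S p <;> simp [scaleOn, h]
  exact congrArg (fun h => h f) this

theorem zeroOn_of_natDegree (S : σ → Prop) [DecidablePred S] (f : MvPolynomial σ K)
    (h : (scaleOn S f).natDegree = 0) : zeroOn S f = f := by
  obtain ⟨c, hc⟩ := Polynomial.natDegree_eq_zero.1 h
  rw [← scaleOn_eval_zero]
  conv_rhs => rw [← scaleOn_eval_one S f]
  rw [← hc]; simp

theorem zeroOn_or [IsDomain K] (S : σ → Prop) [DecidablePred S] (f g d : MvPolynomial σ K)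
    (hd : d ≠ 0) (h : scaleOn S (f * g) = Polynomial.X * Polynomial.C d) :
    zeroOn S f = f ∨ zeroOn S g = g := by
  have h0 : scaleOn S f * scaleOn S g ≠ 0 := by
    rw [← map_mul, h]
    exact mul_ne_zero Polynomial.X_ne_zero (by simpa using hd)
  have h1 : (scaleOn S f * scaleOn S g).natDegree = 1 := by
    rw [← map_mul, h, Polynomial.natDegree_mul Polynomial.X_ne_zero (by simpa using hd)]
    simp
  rw [Polynomial.natDegree_mul (left_ne_zero_of_mul h0) (right_ne_zero_of_mul h0)] at h1
  rcases Nat.eq_zero_or_pos (scaleOn S f).natDegree with h2 | h2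
  · exact Or.inl (zeroOn_of_natDegree S f h2)
  · exact Or.inr (zeroOn_of_natDegree S g (by omega))

theorem zeroOn_mono (S T : σ → Prop) [DecidablePred S] [DecidablePred T] (hTS : ∀ p, T p → S p)
    (f : MvPolynomial σ K) (h : zeroOn S f = f) : zeroOn T f = f := by
  have : (zeroOn T).comp (zeroOn S) = (zeroOn S : MvPolynomial σ K →ₐ[K] _) := by
    apply MvPolynomial.algHom_ext
    intro p
    by_cases h : S p
    · simp [zeroOn, h]
    · have : ¬ T p := fun h' => h (hTS p h')
      simp [zeroOn, h, this]
  have h2 := congrArg (fun h => h f) this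
  simp only [AlgHom.comp_apply] at h2
  rw [h] at h2
  exact h2

theorem const_of_zeroOn [Fintype σ] [DecidableEq σ] (f : MvPolynomial σ K)
    (h : ∀ p : σ, zeroOn (fun q => q = p) f = f) : ∃ c, f = MvPolynomial.C c := by
  have key : ∀ s : Finset σ, zeroOn (fun q => q ∈ s) f = f := by
    intro s
    induction s using Finset.induction_on with
    | empty =>
      have : (zeroOn (fun q => q ∈ (∅ : Finset σ)) : MvPolynomial σ K →ₐ[K] _) = AlgHom.id _ _ := by
        apply MvPolynomial.algHom_ext
        intro p
        simp [zeroOn]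
      rw [this]; rfl
    | insert a s ha ih =>
      have : (zeroOn (fun q => q ∈ insert a s) : MvPolynomial σ K →ₐ[K] _) =
          (zeroOn (fun q => q ∈ s)).comp (zeroOn (fun q => q = a)) := by
        apply MvPolynomial.algHom_ext
        intro p
        by_cases h : p = a <;> simp [zeroOn, h]
      rw [this, AlgHom.comp_apply, h, ih]
  refine ⟨MvPolynomial.constantCoeff f, ?_⟩
  have h1 := key Finset.univ
  have : (zeroOn (fun q => q ∈ (Finset.univ : Finset σ)) : MvPolynomial σ K →ₐ[K] _).toRingHom =
      MvPolynomial.C.comp MvPolynomial.constantCoeff := by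
    apply MvPolynomial.ringHom_ext
    · intro r; simp [zeroOn, MvPolynomial.algebraMap_eq]
    · intro p; simp [zeroOn]
  have h2 := congrArg (fun h => h f) this
  exact h1.symm.trans h2
end

section
variable {n : ℕ} {K : Type*} [CommRing K]

/-- The generic matrix. -/
noncomputable abbrev genMat (n : ℕ) (K : Type*) [CommRing K] :
    Matrix (Fin n) (Fin n) (MvPolynomial (Fin n × Fin n) K) :=
  Matrix.mvPolynomialX (Fin n) (Fin n) K

theorem scale_row_s3 (i : Fin n) :
    scaleOn (fun q : Fin n × Fin n => q.1 = i) (genMat n K).det =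
      Polynomial.X * Polynomial.C (genMat n K).det := by
  rw [AlgHom.map_det, RingHom.map_det]
  have h := Matrix.det_mul_column (fun a : Fin n => if a = i then
    (Polynomial.X : Polynomial (MvPolynomial (Fin n × Fin n) K)) else 1)
    (Polynomial.C.mapMatrix (genMat n K))
  rw [Finset.prod_ite_eq' Finset.univ i, if_pos (Finset.mem_univ _)] at h
  rw [← h]
  congr 1
  ext1 a b
  simp [scaleOn, Matrix.mvPolynomialX]

theorem scale_col_s3 (j : Fin n) :
    scaleOn (fun q : Fin n × Fin n => q.2 = j) (genMat n K).det =
      Polynomial.X * Polynomial.C (genMat n K).det := by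
  rw [AlgHom.map_det, RingHom.map_det]
  have h := Matrix.det_mul_row (fun a : Fin n => if a = j then
    (Polynomial.X : Polynomial (MvPolynomial (Fin n × Fin n) K)) else 1)
    (Polynomial.C.mapMatrix (genMat n K))
  rw [Finset.prod_ite_eq' Finset.univ j, if_pos (Finset.mem_univ _)] at h
  rw [← h]
  congr 1
  ext1 a b
  simp [scaleOn, Matrix.mvPolynomialX]

theorem eval_gen (A : Matrix (Fin n) (Fin n) K) :
    MvPolynomial.eval (fun p => A p.1 p.2) (genMat n K).det = A.det := by
  rw [RingHom.map_det]
  congr 1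
  ext1 a b
  simp [Matrix.mvPolynomialX]

theorem zeroOn_det_ne [Nontrivial K] (p : Fin n × Fin n) :
    zeroOn (fun q => q = p) (genMat n K).det ≠ (genMat n K).det := by
  intro h
  obtain ⟨i, j⟩ := p
  let A : Matrix (Fin n) (Fin n) K := (Equiv.swap i j).permMatrix K
  have h1 := congrArg (MvPolynomial.eval (fun p => A p.1 p.2)) h
  rw [eval_gen, AlgHom.map_det, RingHom.map_det, Matrix.det_permutation] at h1
  rw [Matrix.det_eq_zero_of_row_eq_zero i] at h1
  · have h2 : IsUnit (((Equiv.Perm.sign (Equiv.swap i j) : ℤ)) : K) :=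
      (Equiv.Perm.sign (Equiv.swap i j)).isUnit.map (Int.castRingHom K)
    rw [← h1] at h2
    exact not_isUnit_zero h2
  · intro b
    by_cases hb : b = j
    · simp [zeroOn, Matrix.mvPolynomialX, hb]
    · simp [zeroOn, Matrix.mvPolynomialX, hb, A, Equiv.Perm.permMatrix, PEquiv.toMatrix_apply,
        Ne.symm hb]

theorem incompat [Nontrivial K] (f g : MvPolynomial (Fin n × Fin n) K)
    (h : (genMat n K).det = f * g) (i j : Fin n)
    (hf : zeroOn (fun q : Fin n × Fin n => q.1 = i) f = f)
    (hg : zeroOn (fun q : Fin n × Fin n => q.2 = j) g = g) : False := by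
  apply zeroOn_det_ne (K := K) (i, j)
  rw [h, map_mul, zeroOn_mono _ _ _ f hf, zeroOn_mono _ _ _ g hg]
  · rintro p rfl; rfl
  · rintro p rfl; rfl

theorem factor_const [IsDomain K] (f g : MvPolynomial (Fin n × Fin n) K)
    (h : (genMat n K).det = f * g) (i : Fin n)
    (hf : zeroOn (fun q : Fin n × Fin n => q.1 = i) f = f) : ∃ c, f = MvPolynomial.C c := by
  apply const_of_zeroOn
  rintro ⟨a, b⟩
  have hb : zeroOn (fun q : Fin n × Fin n => q.2 = b) f = f := by
    rcases zeroOn_or (fun q : Fin n × Fin n => q.2 = b) f g _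
      (Matrix.det_mvPolynomialX_ne_zero (Fin n) K) (h ▸ scale_col_s3 b) with h1 | h1
    · exact h1
    · exact (incompat f g h i b hf h1).elim
  refine zeroOn_mono _ _ ?_ f hb
  rintro p rfl; rfl

theorem const_unit {F : Type*} [Field F] (f g : MvPolynomial (Fin n × Fin n) F)
    (h : (genMat n F).det = f * g) (hf : ∃ c, f = MvPolynomial.C c) : IsUnit f := by
  obtain ⟨c, rfl⟩ := hf
  have : c ≠ 0 := by
    rintro rfl
    apply Matrix.det_mvPolynomialX_ne_zero (Fin n) F
    rw [h]; simp
  exact (IsUnit.mk0 c this).map MvPolynomial.C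

theorem prime_det {F : Type*} [Field F] (hn : 0 < n) : Prime (genMat n F).det := by
  rw [← irreducible_iff_prime]
  have i : Fin n := ⟨0, hn⟩
  constructor
  · intro hu
    have h2 := hu.map (MvPolynomial.eval (fun p => (0 : Matrix (Fin n) (Fin n) F) p.1 p.2))
    have : Nonempty (Fin n) := ⟨i⟩
    rw [eval_gen, Matrix.det_zero] at h2
    exact not_isUnit_zero h2
  · intro f g h
    rcases zeroOn_or (fun q : Fin n × Fin n => q.1 = i) f g _
      (Matrix.det_mvPolynomialX_ne_zero (Fin n) F) (h ▸ scale_row_s3 i) with h1 | h1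
    · exact Or.inl (const_unit f g h (factor_const f g h i h1))
    · have h' := h.trans (mul_comm f g)
      exact Or.inr (const_unit g f h' (factor_const g f h' i h1))

theorem descend_s3 [IsDomain K] (y z : MvPolynomial (Fin n × Fin n) K) (m i : ℕ)
    (h : y * z = (genMat n K).det ^ m)
    (hy : Associated (MvPolynomial.map (algebraMap K (FractionRing K)) y)
      ((genMat n (FractionRing K)).det ^ i)) : Associated y ((genMat n K).det ^ i) := by
  let e := fun {R : Type _} [CommRing R] => MvPolynomial.eval
    (fun p : Fin n × Fin n => (1 : Matrix (Fin n) (Fin n) R) p.1 p.2)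
  have hyz : e y * e z = 1 := by
    have := congrArg e h
    rw [map_mul, map_pow] at this
    rw [this]; simp only [e]; rw [eval_gen]; simp
  have hD : MvPolynomial.map (algebraMap K (FractionRing K)) (genMat n K).det =
      (genMat n (FractionRing K)).det := by
    rw [RingHom.map_det]
    congr 1
    ext1 a b
    simp [Matrix.mvPolynomialX]
  have hmap : ∀ f : MvPolynomial (Fin n × Fin n) K,
      e (MvPolynomial.map (algebraMap K (FractionRing K)) f) =
        algebraMap K (FractionRing K) (e f) := by
    intro f
    have : (e (R := FractionRing K)).comp (MvPolynomial.map (algebraMap K (FractionRing K))) =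
        (algebraMap K (FractionRing K)).comp (e (R := K)) := by
      apply MvPolynomial.ringHom_ext
      · intro r; simp [e]
      · intro p; simp [e, Matrix.one_apply, apply_ite]
    exact congrArg (fun h => h f) this
  obtain ⟨u, hu⟩ := hy.symm
  obtain ⟨c, hc, hc'⟩ := MvPolynomial.isUnit_iff_eq_C_of_isReduced.1 u.isUnit
  rw [hc'] at hu
  have hce : c = algebraMap K (FractionRing K) (e y) := by
    rw [← hmap, ← hu, map_mul, map_pow]
    simp only [e]; rw [eval_gen]; simp
  have hfin : (genMat n K).det ^ i * MvPolynomial.C (e y) = y := by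
    apply MvPolynomial.map_injective _ (IsFractionRing.injective K (FractionRing K))
    rw [← hu, map_mul, map_pow, hD, hce, MvPolynomial.map_C]
  have hunit : IsUnit (MvPolynomial.C (e y) : MvPolynomial (Fin n × Fin n) K) :=
    (IsUnit.of_mul_eq_one _ hyz).map MvPolynomial.C
  exact Associated.symm ⟨hunit.unit, hfin⟩

theorem main_assoc [IsDomain K] (hn : 0 < n) (y z : MvPolynomial (Fin n × Fin n) K) (m : ℕ)
    (h : y * z = (genMat n K).det ^ m) :
    ∃ i ≤ m, Associated y ((genMat n K).det ^ i) ∧ Associated z ((genMat n K).det ^ (m - i)) := by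
  have hD : MvPolynomial.map (algebraMap K (FractionRing K)) (genMat n K).det =
      (genMat n (FractionRing K)).det := by
    rw [RingHom.map_det]
    congr 1
    ext1 a b
    simp [Matrix.mvPolynomialX]
  have h1 : MvPolynomial.map (algebraMap K (FractionRing K)) y ∣
      (genMat n (FractionRing K)).det ^ m := by
    rw [← hD, ← map_pow, ← h, map_mul]
    exact dvd_mul_right _ _
  obtain ⟨i, him, hi⟩ := (dvd_prime_pow (prime_det hn) m).1 h1
  have hy := descend_s3 y z m i h hi
  refine ⟨i, him, hy, ?_⟩
  have h2 : Associated (y * z) ((genMat n K).det ^ i * (genMat n K).det ^ (m - i)) := by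
    rw [h, ← pow_add, Nat.add_sub_cancel' him]
  exact Associated.of_mul_left h2 hy
    (fun h0 => pow_ne_zero m (Matrix.det_mvPolynomialX_ne_zero (Fin n) K) (by rw [← h, h0, zero_mul]))
end

/-- If the adjugate of the generic `n × n` matrix `X` over an integral domain `k`
factors as `Y * Z` with neither factor invertible, then up to units
`det Y = det X ^ d` and `det Z = det X ^ (n-1-d)` for some `0 < d < n - 1`. -/
theorem adjugate_generic_nontrivial_factor_det
    (k : Type*) [CommRing k] [IsDomain k] (n : ℕ) (hn : 0 < n)
    (X Y Z : Matrix (Fin n) (Fin n) (MvPolynomial (Fin n × Fin n) k))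
    (hX : ∀ i j, X i j = MvPolynomial.X (i, j))
    (hYZ : X.adjugate = Y * Z) (hY : ¬ IsUnit Y) (hZ : ¬ IsUnit Z) :
    ∃ d : ℕ, 0 < d ∧ d < n - 1 ∧ Associated Y.det (X.det ^ d) ∧
      Associated Z.det (X.det ^ (n - 1 - d)) := by

  obtain rfl : X = genMat n k := by
    ext1 i j
    exact (hX i j).trans (Matrix.mvPolynomialX_apply (Fin n) (Fin n) k i j).symm
  have h : Y.det * Z.det = (genMat n k).det ^ (n - 1) := by
    rw [← Matrix.det_mul, ← hYZ, Matrix.det_adjugate, Fintype.card_fin]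
  obtain ⟨d, hd, h1, h2⟩ := main_assoc hn _ _ _ h
  refine ⟨d, ?_, ?_, h1, h2⟩
  · rcases Nat.eq_zero_or_pos d with rfl | h0
    · rw [pow_zero, associated_one_iff_isUnit] at h1
      exact (hY ((Matrix.isUnit_iff_isUnit_det _).2 h1)).elim
    · exact h0
  · rcases hd.eq_or_lt with rfl | h0
    · rw [Nat.sub_self, pow_zero, associated_one_iff_isUnit] at h2
      exact (hZ ((Matrix.isUnit_iff_isUnit_det _).2 h2)).elim
    · exact h0
end

section
/- Let R be a unique factorization domain, p an irreducible element of R, n a positive integer, and M an n×n matrix over R with det(M) ≠ 0. Let v_p(det(M)) denote the multiplicity of p in det(M), i.e., the largest natural number m such that p^m divides det(M). Then the image of M over the quotient domain R/pR has rank (over the fraction field of R/pR) at least n − v_p(det(M)). -/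
/-- Let `R` be a UFD, `p` irreducible, and `M` an `n × n` matrix over `R` with nonzero
determinant.  If `v` is the multiplicity of `p` in `det M` (the largest `m` with
`p ^ m ∣ det M`), then the image of `M` over `R/pR`, regarded over the fraction field of
`R/pR`, has rank at least `n - v`. -/
theorem rank_map_quotient_ge_of_multiplicity
    (R : Type*) [CommRing R] [IsDomain R] [UniqueFactorizationMonoid R]
    (p : R) (hp : Irreducible p) (n : ℕ) (hn : 0 < n)
    (M : Matrix (Fin n) (Fin n) R) (hM : M.det ≠ 0)
    (v : ℕ) (hv : p ^ v ∣ M.det) (hv' : ¬ p ^ (v + 1) ∣ M.det) :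
    n - v ≤ (M.map ((algebraMap (R ⧸ Ideal.span {p})
        (FractionRing (R ⧸ Ideal.span {p}))).comp
        (Ideal.Quotient.mk (Ideal.span {p})))).rank := by
  classical
  have hpp : Prime p := hp.prime
  haveI : (Ideal.span {p}).IsPrime := (Ideal.span_singleton_prime hpp.ne_zero).2 hpp
  set K := FractionRing (R ⧸ Ideal.span {p}) with hK
  set f : R →+* K := (algebraMap (R ⧸ Ideal.span {p}) K).comp
        (Ideal.Quotient.mk (Ideal.span {p})) with hf
  have hker : ∀ x, f x = 0 ↔ p ∣ x := by
    intro x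
    rw [hf, RingHom.comp_apply,
      map_eq_zero_iff _ (IsFractionRing.injective (R ⧸ Ideal.span {p}) K),
      Ideal.Quotient.eq_zero_iff_mem, Ideal.mem_span_singleton]
  obtain ⟨V, U, e, hV, hU, hVU⟩ := Matrix.exists_rank_normal_form (M.map f)
  obtain ⟨b, hb⟩ := IsLocalization.exist_integer_multiples_of_finite
    (nonZeroDivisors (R ⧸ Ideal.span {p})) (fun ij : Fin n × Fin n => V ij.1 ij.2)
  set c : K := algebraMap (R ⧸ Ideal.span {p}) K b with hc
  have hc0 : c ≠ 0 := IsFractionRing.to_map_ne_zero_of_mem_nonZeroDivisors b.2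
  have hlift : ∀ i j, ∃ x : R, f x = c * V i j := by
    intro i j
    obtain ⟨y, hy⟩ := hb (i, j)
    obtain ⟨x, rfl⟩ := Ideal.Quotient.mk_surjective y
    exact ⟨x, by rw [hf, RingHom.comp_apply, hy, Algebra.smul_def]⟩
  choose P hP using hlift
  have hPmap : (Matrix.of P).map f = c • V := by
    ext i j
    simp [hP]
  have hPdet : ¬ p ∣ (Matrix.of P).det := by
    rw [← hker, RingHom.map_det, RingHom.mapMatrix_apply, hPmap, Matrix.det_smul]
    exact mul_ne_zero (pow_ne_zero _ hc0) ((Matrix.isUnit_iff_isUnit_det _).1 hV).ne_zero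
  -- rows that vanish
  have hrow : ∀ i k, e i = Sum.inr k → ∀ j, p ∣ (Matrix.of P * M) i j := by
    intro i k hik j
    rw [← hker]
    have h1 : f ((Matrix.of P * M) i j) = (c • (V * M.map f)) i j := by
      rw [← Matrix.smul_mul, ← hPmap, ← Matrix.map_mul, Matrix.map_apply]
    obtain ⟨U', hU'⟩ := hU.exists_right_inv
    have h2 : V * M.map f = (Matrix.fromBlocks 1 0 0 0).submatrix e e * U' := by
      rw [← hVU, mul_assoc, hU', mul_one]
    rw [h1, h2, Matrix.smul_apply, Matrix.mul_apply, Finset.sum_eq_zero, smul_zero]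
    intro l _
    rw [Matrix.submatrix_apply, hik]
    rcases e l with a | a <;> simp
  set w : Fin n → R := fun i => Sum.elim (fun _ => 1) (fun _ => p) (e i) with hw
  have hdiv : ∀ i j, ∃ y, (Matrix.of P * M) i j = w i * y := by
    intro i j
    rcases h : e i with a | a
    · exact ⟨_, by simp only [hw, h, Sum.elim_inl, one_mul]; rfl⟩
    · obtain ⟨y, hy⟩ := hrow i a h j
      exact ⟨y, by simp only [hw, h, Sum.elim_inr, hy]⟩
  choose N hN using hdiv
  have hprod : ∏ i, w i = p ^ (n - (M.map f).rank) := by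
    rw [hw, Equiv.prod_comp e (Sum.elim (fun _ => 1) (fun _ => p)), Fintype.prod_sum_type]
    simp
  have hdet : (Matrix.of P).det * M.det = p ^ (n - (M.map f).rank) * (Matrix.of N).det := by
    rw [← Matrix.det_mul, ← hprod, ← Matrix.det_mul_column]
    congr 1
    ext i j
    exact hN i j
  have hd : p ^ (n - (M.map f).rank) ∣ M.det :=
    hpp.pow_dvd_of_dvd_mul_left _ hPdet (Dvd.intro _ hdet.symm)
  have hle : n - (M.map f).rank ≤ v := by
    by_contra! h
    exact hv' ((pow_dvd_pow p h).trans hd)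
  change n - v ≤ (M.map f).rank
  omega
end

section
/- Let k be a field, n a positive integer, X the generic n×n matrix over k[x_{ij}], and d a natural number with d ≤ n−1. Suppose Y is an n×n matrix over k[x_{ij}] with det(Y) = det(X)^d. Let A be an n×n matrix over k whose characteristic polynomial has 0 as a root of multiplicity exactly 1, and let φ_A : k[x_{ij}] → k be the evaluation homomorphism sending each x_{ij} to the (i,j) entry of A. Then the matrix φ_A(Y), obtained by applying φ_A entrywise to Y, has rank at least n − d. -/
theorem X_pow_dvd_det_aux {k : Type*} [Field k] {n : ℕ}
    (B : Matrix (Fin n) (Fin n) (Polynomial k)) :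
    (Polynomial.X : Polynomial k) ^ (n - (B.map (Polynomial.eval 0)).rank) ∣ B.det := by
  classical
  obtain ⟨L, L', D, h⟩ :=
    Matrix.Pivot.exists_list_transvec_mul_mul_list_transvec_eq_diagonal (B.map (Polynomial.eval 0))
  set P := (L.map Matrix.TransvectionStruct.toMatrix).prod with hP
  set Q := (L'.map Matrix.TransvectionStruct.toMatrix).prod with hQ
  have hPd : P.det = 1 := Matrix.TransvectionStruct.det_toMatrix_prod L
  have hQd : Q.det = 1 := Matrix.TransvectionStruct.det_toMatrix_prod L'
  have hrank : (B.map (Polynomial.eval 0)).rank = Fintype.card {i // D i ≠ 0} := by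
    rw [← Matrix.rank_diagonal D, ← h,
      Matrix.rank_mul_eq_left_of_isUnit_det _ _ (by rw [hQd]; exact isUnit_one),
      Matrix.rank_mul_eq_right_of_isUnit_det _ _ (by rw [hPd]; exact isUnit_one)]
  set E := P.map (Polynomial.C : k →+* Polynomial k) * B * Q.map (Polynomial.C : k →+* Polynomial k)
    with hE
  have hEd : E.det = B.det := by
    have e : ∀ M : Matrix (Fin n) (Fin n) k,
        (M.map (Polynomial.C : k →+* Polynomial k)).det = Polynomial.C M.det := fun M =>
      ((Polynomial.C : k →+* Polynomial k).map_det M).symm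
    rw [hE, Matrix.det_mul, Matrix.det_mul, e, e, hPd, hQd]; simp
  have hE0 : E.map (Polynomial.evalRingHom (0 : k)) = Matrix.diagonal D := by
    rw [hE, Matrix.map_mul, Matrix.map_mul, ← h]
    congr 1
    · congr 1
      ext i j; simp
    · ext i j; simp
  have hdvd : ∀ i j, ∃ c, E i j = c * (if D j = 0 then Polynomial.X else 1) := by
    intro i j
    split_ifs with hj
    · have h1 : (E i j).eval 0 = 0 := by
        have := congrFun (congrFun hE0 i) j
        simp only [Matrix.map_apply, Polynomial.coe_evalRingHom] at this
        rw [this]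
        by_cases hij : i = j
        · subst hij; simpa using hj
        · simp [hij]
      obtain ⟨c, hc⟩ : Polynomial.X ∣ E i j := by
        rwa [Polynomial.X_dvd_iff, Polynomial.coeff_zero_eq_eval_zero]
      exact ⟨c, by rw [hc, mul_comm]⟩
    · exact ⟨E i j, by simp⟩
  choose F hF using hdvd
  have hfac : E = Matrix.of F *
      Matrix.diagonal (fun j => if D j = 0 then (Polynomial.X : Polynomial k) else 1) := by
    ext1 i j
    rw [Matrix.mul_diagonal, hF]; rfl
  rw [← hEd, hfac, Matrix.det_mul, Matrix.det_diagonal, Finset.prod_ite, Finset.prod_const,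
    Finset.prod_const_one, mul_one, hrank]
  apply Dvd.dvd.mul_left
  apply pow_dvd_pow
  have := Finset.card_filter_add_card_filter_not (s := (Finset.univ : Finset (Fin n))) (fun i => D i = 0)
  rw [Fintype.card_subtype]
  simp only [Finset.card_univ, Fintype.card_fin] at this
  simp only [ne_eq]
  omega

/-- Let `X` be the generic `n × n` matrix over a field `k`, and `Y` a matrix over
`k[xᵢⱼ]` with `det Y = det X ^ d`, `d ≤ n - 1`.  If `A` is an `n × n` matrix over `k`
whose characteristic polynomial has `0` as a root of multiplicity exactly `1`, then the
entrywise evaluation of `Y` at `A` has rank at least `n - d`. -/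
theorem rank_eval_ge_of_det_eq_pow
    (k : Type*) [Field k] (n : ℕ) (hn : 0 < n)
    (X Y : Matrix (Fin n) (Fin n) (MvPolynomial (Fin n × Fin n) k))
    (hX : ∀ i j, X i j = MvPolynomial.X (i, j))
    (d : ℕ) (hd : d ≤ n - 1) (hY : Y.det = X.det ^ d)
    (A : Matrix (Fin n) (Fin n) k)
    (hA : Polynomial.X ∣ A.charpoly) (hA' : ¬ Polynomial.X ^ 2 ∣ A.charpoly) :
    n - d ≤ (Y.map (MvPolynomial.eval fun p => A p.1 p.2)).rank := by
  let ψ : MvPolynomial (Fin n × Fin n) k →+* Polynomial k :=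
    MvPolynomial.eval₂Hom Polynomial.C (fun p => (-A.charmatrix) p.1 p.2)
  have hψX : X.map ψ = -A.charmatrix := by
    ext1 i j
    simp [hX, ψ]
  have hcomp : (Polynomial.evalRingHom (0 : k)).comp ψ
      = MvPolynomial.eval fun p => A p.1 p.2 := by
    apply MvPolynomial.ringHom_ext
    · intro r; simp [ψ]
    · rintro ⟨i, j⟩
      by_cases hij : i = j
      · subst hij; simp [ψ]
      · simp [ψ, hij]
  have hmap : (Y.map ψ).map (Polynomial.eval 0)
      = Y.map (MvPolynomial.eval fun p => A p.1 p.2) := by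
    ext i j
    rw [← hcomp]; simp
  have key := X_pow_dvd_det_aux (Y.map ψ)
  rw [hmap] at key
  have hdet : (Y.map ψ).det = ((-1) ^ n * A.charpoly) ^ d := by
    have e1 : (Y.map ψ).det = ψ Y.det := (ψ.map_det Y).symm
    have e2 : (X.map ψ).det = ψ X.det := (ψ.map_det X).symm
    rw [e1, hY, map_pow, ← e2, hψX, Matrix.det_neg, Fintype.card_fin]; rfl
  by_contra hlt
  push Not at hlt
  have h1 : (Polynomial.X : Polynomial k) ^ (d + 1) ∣ ((-1) ^ n * A.charpoly) ^ d := by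
    rw [← hdet]
    exact (pow_dvd_pow _ (by omega)).trans key
  obtain ⟨q, hq⟩ := hA
  rw [hq, mul_left_comm, mul_pow, pow_succ,
    mul_dvd_mul_iff_left (pow_ne_zero _ Polynomial.X_ne_zero)] at h1
  have h2 := Polynomial.prime_X.dvd_of_dvd_pow h1
  have hu : IsUnit ((-1 : Polynomial k) ^ n) := (isUnit_one.neg).pow n
  rw [hu.dvd_mul_left] at h2
  apply hA'
  rw [hq, pow_two]
  exact mul_dvd_mul_left _ h2
end

section
/- Let k be a field, n a positive integer, X the generic n×n matrix over k[x_{ij}], and adj(X) its adjugate. Suppose adj(X) = Y·Z where Y, Z are n×n matrices over k[x_{ij}] with det(Y) = det(X)^d and det(Z) = det(X)^{n−1−d} for some natural number d ≤ n−1. Let A be an n×n matrix over k whose characteristic polynomial has 0 as a root of multiplicity exactly 1, and let φ_A : k[x_{ij}] → k be the evaluation homomorphism sending x_{ij} to A_{ij}. Then rank(φ_A(Y)) = n − d, rank(φ_A(Z)) = d + 1, rank(φ_A(X·Y)) = n − 1 − d, and rank(φ_A(Z·X)) = d, where φ_A is applied entrywise to matrices. -/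
theorem aux_dvd {k : Type*} [Field k] {n : ℕ} (M : Matrix (Fin n) (Fin n) (Polynomial k)) :
    Polynomial.X ^ (n - (M.map (Polynomial.evalRingHom (0:k))).rank) ∣ M.det := by
  classical
  obtain ⟨L, L', D, h⟩ := Matrix.Pivot.exists_list_transvec_mul_mul_list_transvec_eq_diagonal
    (M.map (Polynomial.evalRingHom (0:k)))
  set P := (L.map Matrix.TransvectionStruct.toMatrix).prod with hP
  set Q := (L'.map Matrix.TransvectionStruct.toMatrix).prod with hQ
  have hPd : P.det = 1 := Matrix.TransvectionStruct.det_toMatrix_prod L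
  have hQd : Q.det = 1 := Matrix.TransvectionStruct.det_toMatrix_prod L'
  have hr : (M.map (Polynomial.evalRingHom (0:k))).rank = Fintype.card {i // D i ≠ 0} := by
    rw [← Matrix.rank_diagonal, ← h, Matrix.rank_mul_eq_left_of_isUnit_det _ _ (by simp [hQd]),
      Matrix.rank_mul_eq_right_of_isUnit_det _ _ (by simp [hPd])]
  set N := P.map Polynomial.C * M * Q.map Polynomial.C with hN
  have hNd : N.det = M.det := by
    have h1 : (P.map (Polynomial.C : k →+* _)).det = 1 := by
      have := (RingHom.map_det (Polynomial.C : k →+* _) P).symm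
      simpa [hPd] using this
    have h2 : (Q.map (Polynomial.C : k →+* _)).det = 1 := by
      have := (RingHom.map_det (Polynomial.C : k →+* _) Q).symm
      simpa [hQd] using this
    rw [hN, Matrix.det_mul, Matrix.det_mul, h1, h2]; simp
  have hN0 : N.map (Polynomial.evalRingHom (0:k)) = Matrix.diagonal D := by
    rw [← h, hN, Matrix.map_mul, Matrix.map_mul, Matrix.map_map, Matrix.map_map]
    congr 2
    · ext; simp
    · ext; simp
  have hdiv : ∀ i, ∃ v : Fin n → Polynomial k, ∀ j,
      N i j = (if D i = 0 then Polynomial.X else 1) * v j := by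
    intro i
    by_cases hi : D i = 0
    · have : ∀ j, Polynomial.X ∣ N i j := by
        intro j
        have := congrFun (congrFun hN0 i) j
        rw [Polynomial.X_dvd_iff, Polynomial.coeff_zero_eq_eval_zero]
        by_cases hij : i = j
        · subst hij; simpa [hi] using this
        · simpa [hij] using this
      choose v hv using this
      exact ⟨v, fun j => by simp [hi, hv j]⟩
    · exact ⟨N i, fun j => by simp [hi]⟩
  choose N' hN' using hdiv
  have : N = Matrix.diagonal (fun i => if D i = 0 then (Polynomial.X : Polynomial k) else 1)
      * Matrix.of N' := by
    ext1 i j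
    rw [Matrix.diagonal_mul, hN' i j]; rfl
  rw [← hNd, this, Matrix.det_mul, Matrix.det_diagonal, hr]
  apply Dvd.dvd.mul_right
  rw [Finset.prod_ite]
  have hc : n - Fintype.card {i // D i ≠ 0} = (Finset.univ.filter fun i => D i = 0).card := by
    have := Fintype.card_subtype_compl (fun i => D i = 0)
    have h3 := Fintype.card_subtype_le (fun i => D i = 0)
    rw [← Fintype.card_subtype]
    simp only [Fintype.card_fin] at this h3
    simp only [ne_eq]
    omega
  rw [hc]; simp

theorem aux_le {k : Type*} [Field k] {n : ℕ} (M : Matrix (Fin n) (Fin n) (Polynomial k))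
    (p : Polynomial k) (hp : Polynomial.X ∣ p) (hp' : ¬ Polynomial.X ^ 2 ∣ p) (m : ℕ)
    (hM : M.det = p ^ m) :
    n ≤ (M.map (Polynomial.evalRingHom (0:k))).rank + m := by
  have h := aux_dvd M
  rw [hM] at h
  by_contra hlt
  obtain ⟨q, rfl⟩ := hp
  have h2 : Polynomial.X ^ (m + 1) ∣ (Polynomial.X * q) ^ m :=
    (pow_dvd_pow _ (by omega)).trans h
  rw [mul_pow, pow_succ] at h2
  have h3 := (mul_dvd_mul_iff_left (pow_ne_zero m Polynomial.X_ne_zero)).1 h2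
  have h4 := Polynomial.prime_X.dvd_of_dvd_pow h3
  exact hp' (by rw [pow_two]; exact mul_dvd_mul_left _ h4)

theorem rank_eval_of_adjugate_factorization
    (k : Type*) [Field k] (n : ℕ) (hn : 0 < n)
    (X Y Z : Matrix (Fin n) (Fin n) (MvPolynomial (Fin n × Fin n) k))
    (hX : ∀ i j, X i j = MvPolynomial.X (i, j))
    (d : ℕ) (hd : d ≤ n - 1)
    (hYZ : X.adjugate = Y * Z)
    (hY : Y.det = X.det ^ d) (hZ : Z.det = X.det ^ (n - 1 - d))
    (A : Matrix (Fin n) (Fin n) k)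
    (hA : Polynomial.X ∣ A.charpoly) (hA' : ¬ Polynomial.X ^ 2 ∣ A.charpoly) :
    (Y.map (MvPolynomial.eval fun p => A p.1 p.2)).rank = n - d ∧
    (Z.map (MvPolynomial.eval fun p => A p.1 p.2)).rank = d + 1 ∧
    ((X * Y).map (MvPolynomial.eval fun p => A p.1 p.2)).rank = n - 1 - d ∧
    ((Z * X).map (MvPolynomial.eval fun p => A p.1 p.2)).rank = d := by
  classical
  set φ := MvPolynomial.eval fun p : Fin n × Fin n => A p.1 p.2 with hφ
  let ψ : MvPolynomial (Fin n × Fin n) k →+* Polynomial k :=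
    MvPolynomial.eval₂Hom Polynomial.C fun p => - A.charmatrix p.1 p.2
  have hcomp : (Polynomial.evalRingHom (0:k)).comp ψ = φ := by
    apply MvPolynomial.ringHom_ext
    · intro r; simp [ψ, hφ]
    · rintro ⟨i, j⟩
      by_cases hij : i = j
      · subst hij; simp [ψ, hφ, Matrix.charmatrix_apply]
      · simp [ψ, hφ, Matrix.charmatrix_apply, hij]
  have hXψ : X.map ψ = - A.charmatrix := by
    ext1 i j; simp [ψ, hX]
  have hdet : ψ X.det = (-1) ^ n * A.charpoly := by
    have := RingHom.map_det ψ X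
    rw [this, RingHom.mapMatrix_apply, hXψ, Matrix.det_neg]; simp [Matrix.charpoly]
  have hu : IsUnit ((-1 : Polynomial k) ^ n) := (isUnit_neg_one).pow n
  have hp : Polynomial.X ∣ ψ X.det := by rw [hdet]; exact hA.mul_left _
  have hp' : ¬ Polynomial.X ^ 2 ∣ ψ X.det := by
    rw [hdet, hu.dvd_mul_left]; exact hA'
  have key : ∀ (M : Matrix (Fin n) (Fin n) (MvPolynomial (Fin n × Fin n) k)) (m : ℕ),
      M.det = X.det ^ m → n ≤ (M.map φ).rank + m := by
    intro M m hM
    have := aux_le (M.map ψ) (ψ X.det) hp hp' m (by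
      have := RingHom.map_det ψ M
      rw [hM, map_pow] at this
      exact this.symm)
    rwa [Matrix.map_map, ← RingHom.coe_comp, hcomp] at this
  have hdet0 : φ X.det = 0 := by
    rw [← hcomp, RingHom.comp_apply]
    obtain ⟨q, hq⟩ := hp
    rw [hq]; simp
  have e1 : (X * Y).map φ * Z.map φ = 0 := by
    rw [← Matrix.map_mul, Matrix.mul_assoc, ← hYZ, Matrix.mul_adjugate]
    ext i j; by_cases hij : i = j <;> simp [Matrix.one_apply, hdet0, hij]
  have e2 : Y.map φ * (Z * X).map φ = 0 := by
    rw [← Matrix.map_mul, ← Matrix.mul_assoc, ← hYZ, Matrix.adjugate_mul]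
    ext i j; by_cases hij : i = j <;> simp [Matrix.one_apply, hdet0, hij]
  have r1 := Matrix.rank_add_rank_le_card_of_mul_eq_zero e1
  have r2 := Matrix.rank_add_rank_le_card_of_mul_eq_zero e2
  rw [Fintype.card_fin] at r1 r2
  have k1 := key Y d hY
  have k2 := key Z _ hZ
  have k3 := key (X * Y) (d + 1) (by rw [Matrix.det_mul, hY]; ring)
  have k4 := key (Z * X) (n - 1 - d + 1) (by rw [Matrix.det_mul, hZ]; ring)
  omega
end
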